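/- Let X and Y be topological spaces, A ⊆ X and B ⊆ Y, and equip X × Y with the product topology. If A is a-open in X and B is a-open in Y, then A × B is a-open in X × Y; and if A is a-closed in X and B is a-closed in Y, then A × B is a-closed in X × Y. -/

import Mathlib

open Set Topology

/-- A set is regular open if it equals the interior of its closure. -/
def RegOpen {X : Type*} [TopologicalSpace X] (U : Set X) : Prop :=
  U = interior (closure U)

/-- The δ-interior of `A`: the union of all regular open sets contained in `A`. -/
def deltaInt {X : Type*} [TopologicalSpace X] (A : Set X) : Set X :=
  ⋃₀ {U : Set X | RegOpen U ∧ U ⊆ A}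

/-- The δ-closure of `A`: the complement of the δ-interior of the complement. -/
def deltaCl {X : Type*} [TopologicalSpace X] (A : Set X) : Set X :=
  (deltaInt Aᶜ)ᶜ

/-- `A` is a-open if `A ⊆ int(cl(δ-int A))`. -/
def AOpen {X : Type*} [TopologicalSpace X] (A : Set X) : Prop :=
  A ⊆ interior (closure (deltaInt A))

/-- `A` is a-closed if its complement is a-open. -/
def AClosed {X : Type*} [TopologicalSpace X] (A : Set X) : Prop :=
  AOpen Aᶜ

/-- `A` is a-locally closed if it is the intersection of an a-open and an a-closed set. -/
def ALocallyClosed {X : Type*} [TopologicalSpace X] (A : Set X) : Prop :=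
  ∃ U V : Set X, AOpen U ∧ AClosed V ∧ A = U ∩ V

/-- `A` is e-open if `A ⊆ cl(δ-int A) ∪ int(δ-cl A)`. -/
def EOpen {X : Type*} [TopologicalSpace X] (A : Set X) : Prop :=
  A ⊆ closure (deltaInt A) ∪ interior (deltaCl A)

/-- `A` is e-closed if its complement is e-open. -/
def EClosed {X : Type*} [TopologicalSpace X] (A : Set X) : Prop :=
  EOpen Aᶜ

/-- `A` is e-locally closed if it is the intersection of an e-open and an e-closed set. -/
def ELocallyClosed {X : Type*} [TopologicalSpace X] (A : Set X) : Prop :=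
  ∃ U V : Set X, EOpen U ∧ EClosed V ∧ A = U ∩ V

/-- The a-closure of `A`: the intersection of all a-closed supersets of `A`. -/
def aCl {X : Type*} [TopologicalSpace X] (A : Set X) : Set X :=
  ⋂₀ {F : Set X | AClosed F ∧ A ⊆ F}

/-- The a-interior of `A`: the union of all a-open subsets of `A`. -/
def aInt {X : Type*} [TopologicalSpace X] (A : Set X) : Set X :=
  ⋃₀ {U : Set X | AOpen U ∧ U ⊆ A}

/-- The e-closure of `A`: the intersection of all e-closed supersets of `A`. -/
def eCl {X : Type*} [TopologicalSpace X] (A : Set X) : Set X :=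
  ⋂₀ {F : Set X | EClosed F ∧ A ⊆ F}

/-- `S` is semi-open if `S ⊆ cl(int S)`. -/
def SemiOpen {X : Type*} [TopologicalSpace X] (S : Set X) : Prop :=
  S ⊆ closure (interior S)

/-- `S` is semi-closed if its complement is semi-open. -/
def SemiClosed {X : Type*} [TopologicalSpace X] (S : Set X) : Prop :=
  SemiOpen Sᶜ

/-- The semi-closure of `U`: the intersection of all semi-closed supersets of `U`. -/
def sCl {X : Type*} [TopologicalSpace X] (U : Set X) : Set X :=
  ⋂₀ {F : Set X | SemiClosed F ∧ U ⊆ F}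

/-- `A` is feebly open if there is an open `U` with `U ⊆ A ⊆ scl(U)`. -/
def FeeblyOpen {X : Type*} [TopologicalSpace X] (A : Set X) : Prop :=
  ∃ U : Set X, IsOpen U ∧ U ⊆ A ∧ A ⊆ sCl U

/-- `A` is feebly closed if its complement is feebly open. -/
def FeeblyClosed {X : Type*} [TopologicalSpace X] (A : Set X) : Prop :=
  FeeblyOpen Aᶜ

/-- `A` is feebly locally closed if it is the intersection of a feebly open and a
feebly closed set. -/
def FeeblyLocallyClosed {X : Type*} [TopologicalSpace X] (A : Set X) : Prop :=
  ∃ U V : Set X, FeeblyOpen U ∧ FeeblyClosed V ∧ A = U ∩ V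

/-- `A` is α-open if `A ⊆ int(cl(int A))`. -/
def AlphaOpen {X : Type*} [TopologicalSpace X] (A : Set X) : Prop :=
  A ⊆ interior (closure (interior A))

/-- `A` is α-closed if its complement is α-open. -/
def AlphaClosed {X : Type*} [TopologicalSpace X] (A : Set X) : Prop :=
  AlphaOpen Aᶜ

/-- `A` is α-locally closed if it is the intersection of an α-open and an α-closed set. -/
def AlphaLocallyClosed {X : Type*} [TopologicalSpace X] (A : Set X) : Prop :=
  ∃ U V : Set X, AlphaOpen U ∧ AlphaClosed V ∧ A = U ∩ V

/-- `X` is submaximal if every dense subset of `X` is open. -/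
def Submaximal (X : Type*) [TopologicalSpace X] : Prop :=
  ∀ A : Set X, closure A = univ → IsOpen A

/-- `X` is a-submaximal if every a-dense subset of `X` is a-open. -/
def ASubmaximal (X : Type*) [TopologicalSpace X] : Prop :=
  ∀ A : Set X, aCl A = univ → AOpen A

/-- `X` is e-submaximal if every e-dense subset of `X` is e-open. -/
def ESubmaximal (X : Type*) [TopologicalSpace X] : Prop :=
  ∀ A : Set X, eCl A = univ → EOpen A

/-- `X` is an e-space if a subset is open precisely when it is e-open. -/
def IsESpace (X : Type*) [TopologicalSpace X] : Prop :=
  ∀ A : Set X, IsOpen A ↔ EOpen A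

theorem RegOpen.prod_aux {X Y : Type*} [TopologicalSpace X] [TopologicalSpace Y]
    {U : Set X} {V : Set Y} (hU : RegOpen U) (hV : RegOpen V) : RegOpen (U ×ˢ V) := by
  unfold RegOpen at *
  rw [closure_prod_eq, interior_prod_eq, ← hU, ← hV]

theorem deltaInt_mono_aux {X : Type*} [TopologicalSpace X] {A B : Set X} (h : A ⊆ B) :
    deltaInt A ⊆ deltaInt B := by
  rintro x ⟨U, ⟨hU, hUA⟩, hx⟩
  exact ⟨U, ⟨hU, hUA.trans h⟩, hx⟩

theorem AOpen.prod_aux {X Y : Type*} [TopologicalSpace X] [TopologicalSpace Y]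
    {A : Set X} {B : Set Y} (hA : AOpen A) (hB : AOpen B) : AOpen (A ×ˢ B) := by
  have h : deltaInt A ×ˢ deltaInt B ⊆ deltaInt (A ×ˢ B) := by
    rintro ⟨x, y⟩ ⟨⟨U, ⟨hU, hUA⟩, hx⟩, ⟨V, ⟨hV, hVB⟩, hy⟩⟩
    exact ⟨U ×ˢ V, ⟨hU.prod_aux hV, Set.prod_mono hUA hVB⟩, ⟨hx, hy⟩⟩
  have h2 := interior_mono (closure_mono h)
  rw [closure_prod_eq, interior_prod_eq] at h2
  exact (Set.prod_mono hA hB).trans h2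

theorem AOpen.union_aux {X : Type*} [TopologicalSpace X] {A B : Set X}
    (hA : AOpen A) (hB : AOpen B) : AOpen (A ∪ B) :=
  Set.union_subset
    (hA.trans (interior_mono (closure_mono (deltaInt_mono_aux Set.subset_union_left))))
    (hB.trans (interior_mono (closure_mono (deltaInt_mono_aux Set.subset_union_right))))

theorem AOpen.univ_aux {X : Type*} [TopologicalSpace X] : AOpen (Set.univ : Set X) := by
  have h : deltaInt (Set.univ : Set X) = Set.univ :=
    Set.eq_univ_of_forall fun x => ⟨Set.univ, ⟨by simp [RegOpen], subset_rfl⟩, trivial⟩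
  simp [AOpen, h]

theorem aOpen_prod_and_aClosed_prod {X Y : Type*} [TopologicalSpace X] [TopologicalSpace Y]
    (A : Set X) (B : Set Y) :
    (AOpen A → AOpen B → AOpen (A ×ˢ B)) ∧
    (AClosed A → AClosed B → AClosed (A ×ˢ B)) := by
  refine ⟨fun hA hB => hA.prod_aux hB, fun hA hB => ?_⟩
  unfold AClosed at *
  rw [Set.compl_prod_eq_union]
  exact (hA.prod_aux AOpen.univ_aux).union_aux (AOpen.univ_aux.prod_aux hB)
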